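/- arXiv:2406.12988 — 2 statements merged into one kernel-verified Lean document; each statement's English description precedes it below -/
import Mathlib

section
/- Let p > 2, T ∈ (0, ∞], and let ψ : [0,T) × ℝ² → ℂ be a smooth function such that ψ(t,·) is a Schwartz function for every t, with ∂_t ψ(t,·) also Schwartz and all spatial derivatives and ∂_t ψ depending continuously on t with seminorm bounds locally uniform in t, satisfying i∂_t ψ + ∂_xx ψ − ∂_yyyy ψ + |ψ|^{p−2}ψ = 0 pointwise. Then the transverse virial quantity V(t) = ∫_{ℝ²} x² |ψ(t,x,y)|² dxdy is twice differentiable on (0,T) and satisfies V''(t) = 8·∫_{ℝ²} |∂_x ψ(t)|² dxdy − (4(p−2)/p)·∫_{ℝ²} |ψ(t)|^p dxdy. -/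
open MeasureTheory

noncomputable section

/-- Partial derivative in the first (x) variable. -/
def pdx (u : ℝ × ℝ → ℂ) : ℝ × ℝ → ℂ := fun z => deriv (fun x => u (x, z.2)) z.1

/-- Partial derivative in the second (y) variable. -/
def pdy (u : ℝ × ℝ → ℂ) : ℝ × ℝ → ℂ := fun z => deriv (fun y => u (z.1, y)) z.2

/-- Second partial derivative in x. -/
def pdxx (u : ℝ × ℝ → ℂ) : ℝ × ℝ → ℂ := pdx (pdx u)

/-- Second partial derivative in y. -/
def pdyy (u : ℝ × ℝ → ℂ) : ℝ × ℝ → ℂ := pdy (pdy u)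

/-- Fourth partial derivative in y. -/
def pdyyyy (u : ℝ × ℝ → ℂ) : ℝ × ℝ → ℂ := pdy (pdy (pdy (pdy u)))

/-- X(u) = ∫ |∂ₓ u|². -/
def Xf (u : ℝ × ℝ → ℂ) : ℝ := ∫ z : ℝ × ℝ, ‖pdx u z‖ ^ 2

/-- Y(u) = ∫ |∂_yy u|². -/
def Yf (u : ℝ × ℝ → ℂ) : ℝ := ∫ z : ℝ × ℝ, ‖pdyy u z‖ ^ 2

/-- M(u) = ∫ |u|². -/
def Mf (u : ℝ × ℝ → ℂ) : ℝ := ∫ z : ℝ × ℝ, ‖u z‖ ^ 2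

/-- P(u) = ∫ |u|ᵖ. -/
def Pf (p : ℝ) (u : ℝ × ℝ → ℂ) : ℝ := ∫ z : ℝ × ℝ, ‖u z‖ ^ p

/-- Energy E(u) = X(u)/2 + Y(u)/2 − P(u)/p. -/
def Ef (p : ℝ) (u : ℝ × ℝ → ℂ) : ℝ := Xf u / 2 + Yf u / 2 - Pf p u / p

/-- Action J_ω(u) = X(u)/2 + Y(u)/2 + (ω/2) M(u) − P(u)/p. -/
def Jf (p ω : ℝ) (u : ℝ × ℝ → ℂ) : ℝ := Xf u / 2 + Yf u / 2 + ω / 2 * Mf u - Pf p u / p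

/-- Standing wave equation −∂ₓₓu + ∂_yyyy u + ω u = |u|^{p−2} u pointwise. -/
def IsStandingWave (p ω : ℝ) (u : ℝ × ℝ → ℂ) : Prop :=
  ∀ z : ℝ × ℝ, -pdxx u z + pdyyyy u z + (ω : ℂ) * u z = ((‖u z‖ ^ (p - 2) : ℝ) : ℂ) * u z

/-- Mass-preserving anisotropic scaling u_λ(x,y) = λ^{3/8} u(λ^{1/2} x, λ^{1/4} y). -/
def uscale (l : ℝ) (u : ℝ × ℝ → ℂ) : ℝ × ℝ → ℂ :=
  fun z => ((l ^ ((3 : ℝ) / 8) : ℝ) : ℂ) * u (l ^ ((1 : ℝ) / 2) * z.1, l ^ ((1 : ℝ) / 4) * z.2)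

end

open scoped ENNReal

open SchwartzMap LineDeriv Filter Topology

noncomputable section

/-- The real `L²` pairing of Schwartz functions. -/
def realPairing (f g : SchwartzMap (ℝ × ℝ) ℂ) : ℝ :=
  integralCLM ℝ volume (pairing (innerSL ℝ) f g)

/-- Multiplication of Schwartz functions by the first coordinate. -/
def mulFst : SchwartzMap (ℝ × ℝ) ℂ →L[ℝ] SchwartzMap (ℝ × ℝ) ℂ :=
  smulLeftCLM ℂ (fun z : ℝ × ℝ => z.1)

/-- Multiplication of Schwartz functions by the imaginary unit. -/
def mulI : SchwartzMap (ℝ × ℝ) ℂ →L[ℝ] SchwartzMap (ℝ × ℝ) ℂ :=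
  postcompCLM (ContinuousLinearMap.mul ℝ ℂ Complex.I)

/-- Directional derivative of Schwartz functions as a continuous linear map. -/
def dirDeriv (v : ℝ × ℝ) : SchwartzMap (ℝ × ℝ) ℂ →L[ℝ] SchwartzMap (ℝ × ℝ) ℂ :=
  lineDerivOpCLM ℝ (SchwartzMap (ℝ × ℝ) ℂ) v

variable (f g h : SchwartzMap (ℝ × ℝ) ℂ) (v w z : ℝ × ℝ)

lemma realPairing_eq_integral : realPairing f g = ∫ z, inner ℝ (f z) (g z) := rfl

lemma integrable_inner : Integrable (fun z => inner ℝ (f z) (g z)) :=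
  (pairing (innerSL ℝ) f g).integrable

lemma realPairing_comm : realPairing f g = realPairing g f := by
  simp only [realPairing_eq_integral, real_inner_comm]

lemma realPairing_add_right : realPairing f (g + h) = realPairing f g + realPairing f h := by
  simp only [realPairing, map_add]

lemma realPairing_sub_right : realPairing f (g - h) = realPairing f g - realPairing f h := by
  simp only [realPairing, map_sub]

lemma realPairing_add_left : realPairing (f + g) h = realPairing f h + realPairing g h := by
  simp only [realPairing, map_add, add_apply]

lemma realPairing_sub_left : realPairing (f - g) h = realPairing f h - realPairing g h := by
  simp only [realPairing, map_sub, sub_apply]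

lemma mulFst_apply : mulFst f z = (z.1 : ℂ) * f z := by
  have : Function.HasTemperateGrowth (fun z : ℝ × ℝ => z.1) :=
    (ContinuousLinearMap.fst ℝ ℝ ℝ).hasTemperateGrowth
  simp [mulFst, smulLeftCLM_apply_apply this]

lemma mulI_apply : mulI f z = Complex.I * f z := rfl

lemma dirDeriv_apply : dirDeriv v f z = fderiv ℝ f z v := rfl

lemma dirDeriv_mulFst : dirDeriv v (mulFst f) = v.1 • f + mulFst (dirDeriv v f) := by
  ext z
  have hx : HasFDerivAt (fun z : ℝ × ℝ => (z.1 : ℂ))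
      (Complex.ofRealCLM ∘L ContinuousLinearMap.fst ℝ ℝ ℝ) z :=
    (Complex.ofRealCLM ∘L ContinuousLinearMap.fst ℝ ℝ ℝ).hasFDerivAt
  have hm : (mulFst f : ℝ × ℝ → ℂ) = fun z => (z.1 : ℂ) * f z := funext (mulFst_apply f)
  rw [dirDeriv_apply, hm, (hx.fun_mul f.differentiableAt.hasFDerivAt).fderiv]
  simp [mulFst_apply, dirDeriv_apply]
  ring

lemma dirDeriv_mulI : dirDeriv v (mulI f) = mulI (dirDeriv v f) := by
  ext z
  have hm : (mulI f : ℝ × ℝ → ℂ) = fun z => Complex.I * f z := rfl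
  rw [dirDeriv_apply, hm, (f.differentiableAt.hasFDerivAt.const_mul Complex.I).fderiv]
  simp [mulI_apply, dirDeriv_apply]

lemma mulFst_mulI : mulFst (mulI f) = mulI (mulFst f) := by
  ext z
  simp only [mulFst_apply, mulI_apply]
  ring

lemma mulI_mulI : mulI (mulI f) = -f := by
  ext z
  simp only [mulI_apply, ← mul_assoc, Complex.I_mul_I, neg_one_mul, neg_apply]

lemma dirDeriv_comm : dirDeriv v (dirDeriv w f) = dirDeriv w (dirDeriv v f) := by
  ext z
  have hs : IsSymmSndFDerivAt ℝ f z :=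
    (f.contDiffAt 2).isSymmSndFDerivAt (by simp)
  have hd : DifferentiableAt ℝ (fderiv ℝ f) z :=
    (fderivCLM ℝ (ℝ × ℝ) ℂ f).differentiableAt
  have key (a b : ℝ × ℝ) : dirDeriv a (dirDeriv b f) z = fderiv ℝ (fderiv ℝ f) z a b := by
    have hm : (dirDeriv b f : ℝ × ℝ → ℂ) = fun z => fderiv ℝ f z b := rfl
    rw [dirDeriv_apply, hm, (hd.hasFDerivAt.clm_apply (hasFDerivAt_const b z)).fderiv]
    simp
  rw [key, key, hs.eq]

lemma realPairing_dirDeriv_right :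
    realPairing f (dirDeriv v g) = -realPairing (dirDeriv v f) g :=
  integral_bilinear_lineDerivOp_right_eq_neg_left f g (innerSL ℝ) v

lemma realPairing_mulFst_right : realPairing f (mulFst g) = realPairing (mulFst f) g := by
  simp only [realPairing_eq_integral, mulFst_apply]
  congr 1 with z
  simp [Complex.inner]
  ring

lemma realPairing_mulI_right : realPairing f (mulI g) = -realPairing (mulI f) g := by
  simp only [realPairing_eq_integral, mulI_apply, ← integral_neg]
  congr 1 with z
  simp [Complex.inner]
  ring

lemma pdx_eq_dirDeriv : pdx f = dirDeriv (1, 0) f := by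
  ext z
  have h := (f.differentiableAt (x := z)).hasFDerivAt.comp_hasDerivAt z.1
    ((hasDerivAt_id z.1).prodMk (hasDerivAt_const z.1 z.2))
  exact h.deriv

lemma pdy_eq_dirDeriv : pdy f = dirDeriv (0, 1) f := by
  ext z
  have h := (f.differentiableAt (x := z)).hasFDerivAt.comp_hasDerivAt z.2
    ((hasDerivAt_const z.2 z.1).prodMk (hasDerivAt_id z.2))
  exact h.deriv

section TimeDerivative

variable {ψ ψ' : ℝ → SchwartzMap (ℝ × ℝ) ℂ} {U : Set ℝ} {t : ℝ}

lemma exists_ball_norm_le (hU : IsOpen U) (hcont' : ContinuousOn ψ' U) (ht : t ∈ U) :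
    ∃ ε > 0, ∃ C, Metric.ball t ε ⊆ U ∧ ∀ s ∈ Metric.ball t ε, ∀ z, ‖ψ' s z‖ ≤ C := by
  have hc : ContinuousAt (fun s => ‖toBoundedContinuousFunctionCLM ℝ (ℝ × ℝ) ℂ (ψ' s)‖) t :=
    ((toBoundedContinuousFunctionCLM ℝ (ℝ × ℝ) ℂ).continuous.continuousAt.comp
      (hcont'.continuousAt (hU.mem_nhds ht))).norm
  obtain ⟨ε, hε, hball⟩ := Metric.eventually_nhds_iff_ball.mp
    ((show ∀ᶠ s in 𝓝 t, s ∈ U from hU.mem_nhds ht).and (hc.eventually_lt_const (lt_add_one _)))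
  exact ⟨ε, hε, _, fun s hs => (hball s hs).1, fun s hs z =>
    ((toBoundedContinuousFunctionCLM ℝ (ℝ × ℝ) ℂ (ψ' s)).norm_coe_le_norm z).trans
      (hball s hs).2.le⟩

lemma hasDerivAt_realPairing_right (hU : IsOpen U) (hcont' : ContinuousOn ψ' U)
    (hderiv : ∀ s ∈ U, ∀ z, HasDerivAt (fun r => ψ r z) (ψ' s z) s) (ht : t ∈ U) :
    HasDerivAt (fun s => realPairing g (ψ s)) (realPairing g (ψ' t)) t := by
  obtain ⟨ε, hε, C, hball, hC⟩ := exists_ball_norm_le hU hcont' ht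
  refine (hasDerivAt_integral_of_dominated_loc_of_deriv_le (μ := volume)
    (F := fun s z => inner ℝ (g z) (ψ s z)) (F' := fun s z => inner ℝ (g z) (ψ' s z))
    (bound := fun z => ‖g z‖ * C) (Metric.ball_mem_nhds t hε)
    (Eventually.of_forall fun s => (integrable_inner g (ψ s)).aestronglyMeasurable)
    (integrable_inner g (ψ t)) (integrable_inner g (ψ' t)).aestronglyMeasurable
    (ae_of_all _ fun z s hs => ?_) (g.integrable.norm.mul_const C)
    (ae_of_all _ fun z s hs => ?_)).2
  · exact (norm_inner_le_norm _ _).trans (mul_le_mul_of_nonneg_left (hC s hs z) (norm_nonneg _))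
  · exact (innerSL ℝ (g z)).hasFDerivAt.comp_hasDerivAt s (hderiv s (hball hs) z)

lemma hasDerivAt_realPairing_sub_zero (A : SchwartzMap (ℝ × ℝ) ℂ →L[ℝ] SchwartzMap (ℝ × ℝ) ℂ)
    (hU : IsOpen U) (hcont : ContinuousOn ψ U) (hcont' : ContinuousOn ψ' U)
    (hderiv : ∀ s ∈ U, ∀ z, HasDerivAt (fun r => ψ r z) (ψ' s z) s) (ht : t ∈ U) :
    HasDerivAt (fun s => realPairing (ψ s - ψ t) (A (ψ s - ψ t))) 0 t := by
  obtain ⟨ε, hε, C, hball, hC⟩ := exists_ball_norm_le hU hcont' ht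
  have hbound : ∀ s ∈ Metric.ball t ε,
      ‖realPairing (ψ s - ψ t) (A (ψ s - ψ t))‖ ≤
        ‖(C * ∫ z, ‖A (ψ s - ψ t) z‖) * (s - t)‖ := by
    intro s hs
    have hlip (z : ℝ × ℝ) : ‖ψ s z - ψ t z‖ ≤ C * ‖s - t‖ :=
      (convex_ball t ε).norm_image_sub_le_of_norm_hasDerivWithin_le
        (fun r hr => (hderiv r (hball hr) z).hasDerivWithinAt) (fun r hr => hC r hr z)
        (Metric.mem_ball_self hε) hs
    have hC0 : 0 ≤ C := (norm_nonneg _).trans (hC s hs 0)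
    rw [realPairing_eq_integral]
    refine (norm_integral_le_of_norm_le
      ((A (ψ s - ψ t)).integrable.norm.const_mul (C * ‖s - t‖))
      (ae_of_all _ fun z => (norm_inner_le_norm _ _).trans
        (mul_le_mul_of_nonneg_right (hlip z) (norm_nonneg _)))).trans_eq ?_
    rw [integral_const_mul, norm_mul, norm_mul, Real.norm_of_nonneg hC0,
      Real.norm_of_nonneg (integral_nonneg fun z => norm_nonneg _)]
    ring
  have hzero : Tendsto (fun s => C * ∫ z, ‖A (ψ s - ψ t) z‖) (𝓝 t) (𝓝 0) := by
    have hc : ContinuousAt (fun s => ‖toLpCLM ℝ ℂ 1 volume (A (ψ s - ψ t))‖) t :=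
      ((toLpCLM ℝ ℂ 1 volume ∘L A).continuous.continuousAt.comp
        ((hcont.continuousAt (hU.mem_nhds ht)).sub continuousAt_const)).norm
    have := hc.tendsto.const_mul C
    simpa only [toLpCLM_apply, norm_toLp_one, sub_self, map_zero, zero_apply, norm_zero,
      integral_zero, mul_zero] using this
  rw [hasDerivAt_iff_isLittleO]
  simp only [sub_self, map_zero, smul_zero, sub_zero]
  have h0 : realPairing (0 : SchwartzMap (ℝ × ℝ) ℂ) 0 = 0 := by simp [realPairing]
  rw [h0]
  simp only [sub_zero]
  refine (Asymptotics.IsBigO.of_bound 1 ?_).trans_isLittleO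
    (((Asymptotics.isLittleO_one_iff ℝ).mpr hzero).mul_isBigO
      (Asymptotics.isBigO_refl (fun s => s - t) _)) |>.congr_right fun s => one_mul _
  filter_upwards [Metric.ball_mem_nhds t hε] with s hs
  rw [one_mul]
  exact hbound s hs

lemma hasDerivAt_realPairing_self (A B : SchwartzMap (ℝ × ℝ) ℂ →L[ℝ] SchwartzMap (ℝ × ℝ) ℂ)
    (hAB : ∀ f g, realPairing f (A g) = realPairing (B f) g)
    (hU : IsOpen U) (hcont : ContinuousOn ψ U) (hcont' : ContinuousOn ψ' U)
    (hderiv : ∀ s ∈ U, ∀ z, HasDerivAt (fun r => ψ r z) (ψ' s z) s) (ht : t ∈ U) :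
    HasDerivAt (fun s => realPairing (ψ s) (A (ψ s)))
      (realPairing (A (ψ t)) (ψ' t) + realPairing (B (ψ t)) (ψ' t)) t := by
  have h := (((hasDerivAt_realPairing_sub_zero A hU hcont hcont' hderiv ht).add
    (hasDerivAt_realPairing_right (A (ψ t)) hU hcont' hderiv ht)).add
    (hasDerivAt_realPairing_right (B (ψ t)) hU hcont' hderiv ht)).sub_const
    (realPairing (ψ t) (A (ψ t)))
  rw [zero_add] at h
  refine h.congr_of_eventuallyEq (Eventually.of_forall fun s => ?_)
  simp only [Pi.add_apply, map_sub, realPairing_sub_left, realPairing_sub_right, ← hAB,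
    realPairing_comm (A (ψ t))]
  ring

end TimeDerivative

lemma realPairing_neg_right : realPairing f (-g) = -realPairing f g := by
  simp only [realPairing, map_neg]

lemma realPairing_mulI_mulI : realPairing (mulI f) (mulI g) = realPairing f g := by
  rw [realPairing_mulI_right, mulI_mulI, realPairing_comm, realPairing_neg_right, neg_neg,
    realPairing_comm]

lemma dirDeriv_fst_mulFst : dirDeriv (1, 0) (mulFst f) = f + mulFst (dirDeriv (1, 0) f) := by
  simp [dirDeriv_mulFst]

lemma dirDeriv_snd_mulFst : dirDeriv (0, 1) (mulFst f) = mulFst (dirDeriv (0, 1) f) := by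
  simp [dirDeriv_mulFst]

lemma realPairing_mulI_self : realPairing f (mulI f) = 0 := by
  have h := realPairing_mulI_right f f
  rw [realPairing_comm (mulI f)] at h
  linarith

lemma realPairing_mulFst_mulFst_right :
    realPairing f (mulFst (mulFst g)) = realPairing (mulFst (mulFst f)) g := by
  rw [realPairing_mulFst_right, realPairing_mulFst_right]

lemma realPairing_mulFst_mulI_dirDeriv_right :
    realPairing f (mulFst (mulI (dirDeriv v g))) = realPairing (dirDeriv v (mulI (mulFst f))) g := by
  rw [realPairing_mulFst_right, realPairing_mulI_right, realPairing_dirDeriv_right, neg_neg]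

lemma two_mul_realPairing_mulFst_dirDeriv :
    2 * realPairing f (mulFst (dirDeriv (1, 0) f)) = -realPairing f f := by
  have h := realPairing_dirDeriv_right (mulFst f) f (1, 0)
  rw [dirDeriv_fst_mulFst, realPairing_add_left, ← realPairing_mulFst_right,
    realPairing_comm (mulFst (dirDeriv (1, 0) f))] at h
  linarith

lemma realPairing_dirDeriv_four :
    realPairing f (dirDeriv v (dirDeriv v (dirDeriv v (dirDeriv v g)))) =
      realPairing (dirDeriv v (dirDeriv v f)) (dirDeriv v (dirDeriv v g)) := by
  rw [realPairing_dirDeriv_right, realPairing_dirDeriv_right, neg_neg]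

lemma realPairing_mulI_of_eq_mul {c : ℝ × ℝ → ℝ} (hg : ∀ z, g z = c z * f z) :
    realPairing (mulFst (mulFst f)) (mulI g) = 0 := by
  rw [realPairing_eq_integral, integral_eq_zero_of_ae]
  refine ae_of_all _ fun z => ?_
  simp [mulFst_apply, mulI_apply, hg, Complex.inner]
  ring

lemma realPairing_virial_first {c : ℝ × ℝ → ℝ} (hg : ∀ z, g z = c z * f z) :
    realPairing (mulFst (mulFst f)) (mulI (dirDeriv (1, 0) (dirDeriv (1, 0) f)
      - dirDeriv (0, 1) (dirDeriv (0, 1) (dirDeriv (0, 1) (dirDeriv (0, 1) f))) + g)) =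
      -2 * realPairing f (mulFst (mulI (dirDeriv (1, 0) f))) := by
  rw [map_add, map_sub, realPairing_add_right, realPairing_sub_right,
    realPairing_mulI_of_eq_mul f g hg]
  have hy : realPairing (mulFst (mulFst f))
      (mulI (dirDeriv (0, 1) (dirDeriv (0, 1) (dirDeriv (0, 1) (dirDeriv (0, 1) f))))) = 0 := by
    simp only [← dirDeriv_mulI]
    rw [realPairing_dirDeriv_four]
    simp only [dirDeriv_snd_mulFst, dirDeriv_mulI]
    rw [← realPairing_mulFst_right, mulFst_mulI, realPairing_mulI_self]
  have hx : realPairing (mulFst (mulFst f)) (mulI (dirDeriv (1, 0) (dirDeriv (1, 0) f))) =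
      -2 * realPairing f (mulFst (mulI (dirDeriv (1, 0) f))) := by
    rw [← dirDeriv_mulI, realPairing_dirDeriv_right, dirDeriv_fst_mulFst, dirDeriv_fst_mulFst,
      map_add, realPairing_add_left, realPairing_add_left, ← realPairing_mulFst_right,
      ← realPairing_mulFst_right (mulFst _), mulFst_mulI, realPairing_mulI_self]
    ring
  rw [hx, hy]
  ring

lemma realPairing_power {p : ℝ} (hp : 2 < p)
    (hg : ∀ z, g z = ((‖f z‖ ^ (p - 2) : ℝ) : ℂ) * f z) :
    realPairing f g = ∫ z, ‖f z‖ ^ p := by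
  rw [realPairing_eq_integral]
  congr 1
  ext z
  rw [hg, ← Complex.real_smul, real_inner_smul_right, real_inner_self_eq_norm_sq,
    ← Real.rpow_natCast, ← Real.rpow_add_of_nonneg (norm_nonneg _) (by linarith) (by simp)]
  simp

lemma realPairing_power_mulFst_dirDeriv {p : ℝ} (hp : 2 < p)
    (hg : ∀ z, g z = ((‖f z‖ ^ (p - 2) : ℝ) : ℂ) * f z) :
    p * realPairing g (mulFst (dirDeriv (1, 0) f)) = -∫ z, ‖f z‖ ^ p := by
  have hpow (h : SchwartzMap (ℝ × ℝ) ℂ) (z : ℝ × ℝ) :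
      inner ℝ (g z) (h z) = ‖f z‖ ^ (p - 2) * inner ℝ (f z) (h z) := by
    rw [hg, ← Complex.real_smul, real_inner_smul_left]
  have hself (z : ℝ × ℝ) : inner ℝ (g z) (f z) = ‖f z‖ ^ p := by
    rw [hpow, real_inner_self_eq_norm_sq, ← Real.rpow_natCast,
      ← Real.rpow_add_of_nonneg (norm_nonneg _) (by linarith) (by simp)]
    simp
  have hmul (h : SchwartzMap (ℝ × ℝ) ℂ) (z : ℝ × ℝ) :
      inner ℝ (g z) (mulFst h z) = z.1 * inner ℝ (g z) (h z) := by
    rw [mulFst_apply, ← Complex.real_smul, real_inner_smul_right]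
  have hderiv (z : ℝ × ℝ) : fderiv ℝ (fun z => ‖f z‖ ^ p) z (1, 0) =
      p * inner ℝ (g z) (dirDeriv (1, 0) f z) := by
    rw [f.differentiable.fderiv_norm_rpow (by linarith), hpow]
    simp [dirDeriv_apply, mul_assoc]
  have hfst (z : ℝ × ℝ) : fderiv ℝ (fun z : ℝ × ℝ => z.1) z (1, 0) = 1 := by
    simp [fderiv_fst]
  have hint := integral_mul_fderiv_eq_neg_fderiv_mul_of_integrable (μ := volume)
    (f := fun z : ℝ × ℝ => z.1) (g := fun z => ‖f z‖ ^ p) (v := ((1, 0) : ℝ × ℝ))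
    (by simpa only [hfst, one_mul, hself] using integrable_inner g f)
    (by
      simpa only [hderiv, hmul, mul_left_comm] using
        (integrable_inner g (mulFst (dirDeriv (1, 0) f))).const_mul p)
    (by simpa only [hmul, hself] using integrable_inner g (mulFst f))
    (fun z _ => differentiableAt_fst)
    (fun z _ => f.differentiable.norm_rpow (by linarith) z)
  simp only [hfst, hderiv, one_mul] at hint
  rw [← hint, realPairing_eq_integral, ← integral_const_mul]
  simp only [hmul, mul_left_comm]

lemma realPairing_virial_second {p : ℝ} (hp : 2 < p)
    (hg : ∀ z, g z = ((‖f z‖ ^ (p - 2) : ℝ) : ℂ) * f z) (F : SchwartzMap (ℝ × ℝ) ℂ)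
    (hF : F = dirDeriv (1, 0) (dirDeriv (1, 0) f)
      - dirDeriv (0, 1) (dirDeriv (0, 1) (dirDeriv (0, 1) (dirDeriv (0, 1) f))) + g) :
    -4 * (realPairing (mulFst (mulI (dirDeriv (1, 0) f))) (mulI F)
        + realPairing (dirDeriv (1, 0) (mulI (mulFst f))) (mulI F)) =
      8 * realPairing (dirDeriv (1, 0) f) (dirDeriv (1, 0) f)
        - (4 * (p - 2) / p) * ∫ z, ‖f z‖ ^ p := by
  rw [mulFst_mulI, dirDeriv_mulI, realPairing_mulI_mulI, realPairing_mulI_mulI,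
    dirDeriv_fst_mulFst, realPairing_add_left]
  have hmain : realPairing (mulFst (dirDeriv (1, 0) f)) F =
      realPairing (mulFst (dirDeriv (1, 0) f)) (dirDeriv (1, 0) (dirDeriv (1, 0) f))
      - realPairing (dirDeriv (0, 1) (dirDeriv (0, 1) f))
          (mulFst (dirDeriv (1, 0) (dirDeriv (0, 1) (dirDeriv (0, 1) f))))
      + realPairing g (mulFst (dirDeriv (1, 0) f)) := by
    rw [hF, realPairing_add_right, realPairing_sub_right, realPairing_dirDeriv_four,
      dirDeriv_snd_mulFst, dirDeriv_snd_mulFst, dirDeriv_comm _ (0, 1) (1, 0),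
      dirDeriv_comm _ (0, 1) (1, 0), realPairing_comm _ g,
      realPairing_comm (mulFst (dirDeriv (1, 0) (dirDeriv (0, 1) (dirDeriv (0, 1) f))))]
  have hself : realPairing f F = -realPairing (dirDeriv (1, 0) f) (dirDeriv (1, 0) f)
      - realPairing (dirDeriv (0, 1) (dirDeriv (0, 1) f)) (dirDeriv (0, 1) (dirDeriv (0, 1) f))
      + ∫ z, ‖f z‖ ^ p := by
    rw [hF, realPairing_add_right, realPairing_sub_right, realPairing_dirDeriv_four,
      realPairing_dirDeriv_right, realPairing_power f g hp hg]
  have hx := two_mul_realPairing_mulFst_dirDeriv (dirDeriv (1, 0) f)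
  rw [realPairing_mulFst_right] at hx
  have hy := two_mul_realPairing_mulFst_dirDeriv (dirDeriv (0, 1) (dirDeriv (0, 1) f))
  have hN : realPairing g (mulFst (dirDeriv (1, 0) f)) = -(∫ z, ‖f z‖ ^ p) / p := by
    rw [← realPairing_power_mulFst_dirDeriv f g hp hg]
    field_simp
  have hc : 4 * (p - 2) / p = 4 - 8 / p := by field_simp; ring
  rw [hmain, hself, hN, hc]
  linear_combination -4 * hx + 4 * hy

end

/-- Transverse virial identity: V''(t) = 8 ∫|∂ₓψ|² − (4(p−2)/p) ∫|ψ|ᵖ on (0,T). -/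
theorem stmt_18 (p : ℝ) (hp : 2 < p) (T : ℝ≥0∞) (hT : 0 < T)
    (ψ ψ' : ℝ → SchwartzMap (ℝ × ℝ) ℂ)
    (hsmooth : ContDiff ℝ (⊤ : ℕ∞) (fun q : ℝ × (ℝ × ℝ) => ψ q.1 q.2))
    (hcont : ContinuousOn ψ {t : ℝ | 0 ≤ t ∧ ENNReal.ofReal t < T})
    (hcont' : ContinuousOn ψ' {t : ℝ | 0 ≤ t ∧ ENNReal.ofReal t < T})
    (hderiv : ∀ t : ℝ, 0 ≤ t → ENNReal.ofReal t < T → ∀ z : ℝ × ℝ,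
      HasDerivAt (fun s => ψ s z) (ψ' t z) t)
    (hpde : ∀ t : ℝ, 0 ≤ t → ENNReal.ofReal t < T → ∀ z : ℝ × ℝ,
      Complex.I * ψ' t z + pdxx (fun w => ψ t w) z - pdyyyy (fun w => ψ t w) z
        + ((‖ψ t z‖ ^ (p - 2) : ℝ) : ℂ) * ψ t z = 0) :
    ∀ t : ℝ, 0 < t → ENNReal.ofReal t < T →
      DifferentiableAt ℝ (fun s => ∫ z : ℝ × ℝ, z.1 ^ 2 * ‖ψ s z‖ ^ 2) t
        ∧ DifferentiableAt ℝ (deriv (fun s => ∫ z : ℝ × ℝ, z.1 ^ 2 * ‖ψ s z‖ ^ 2)) t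
        ∧ deriv (deriv (fun s => ∫ z : ℝ × ℝ, z.1 ^ 2 * ‖ψ s z‖ ^ 2)) t
            = 8 * (∫ z : ℝ × ℝ, ‖pdx (fun w => ψ t w) z‖ ^ 2)
              - (4 * (p - 2) / p) * (∫ z : ℝ × ℝ, ‖ψ t z‖ ^ p) := by
  have hmass (u : SchwartzMap (ℝ × ℝ) ℂ) :
      ∫ z : ℝ × ℝ, z.1 ^ 2 * ‖u z‖ ^ 2 = realPairing u (mulFst (mulFst u)) := by
    rw [realPairing_mulFst_right, realPairing_eq_integral]
    congr 1 with z
    rw [real_inner_self_eq_norm_sq, mulFst_apply, norm_mul, mul_pow, Complex.norm_real,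
      Real.norm_eq_abs, sq_abs]
  have hkin (u : SchwartzMap (ℝ × ℝ) ℂ) : ∫ z : ℝ × ℝ, ‖pdx (fun w => u w) z‖ ^ 2 =
      realPairing (dirDeriv (1, 0) u) (dirDeriv (1, 0) u) := by
    simp only [realPairing_eq_integral, real_inner_self_eq_norm_sq, pdx_eq_dirDeriv]
  set U : Set ℝ := {t | 0 < t ∧ ENNReal.ofReal t < T} with hUdef
  have hU : IsOpen U :=
    (isOpen_lt continuous_const continuous_id).inter
      (isOpen_lt ENNReal.continuous_ofReal continuous_const)
  have hsub : U ⊆ {t : ℝ | 0 ≤ t ∧ ENNReal.ofReal t < T} := fun t ht => ⟨ht.1.le, ht.2⟩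
  have hd : ∀ s ∈ U, ∀ z, HasDerivAt (fun r => ψ r z) (ψ' s z) s :=
    fun s hs => hderiv s hs.1.le hs.2
  have hpower : ∀ s ∈ U, ∃ N : SchwartzMap (ℝ × ℝ) ℂ,
      (∀ z, N z = ((‖ψ s z‖ ^ (p - 2) : ℝ) : ℂ) * ψ s z) ∧
      ψ' s = mulI (dirDeriv (1, 0) (dirDeriv (1, 0) (ψ s)) - dirDeriv (0, 1) (dirDeriv (0, 1)
        (dirDeriv (0, 1) (dirDeriv (0, 1) (ψ s)))) + N) := by
    intro s hs
    refine ⟨dirDeriv (0, 1) (dirDeriv (0, 1) (dirDeriv (0, 1) (dirDeriv (0, 1) (ψ s))))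
      - dirDeriv (1, 0) (dirDeriv (1, 0) (ψ s)) - mulI (ψ' s), fun z => ?_, ?_⟩
    · have h := hpde s hs.1.le hs.2 z
      simp only [pdxx, pdyyyy, pdx_eq_dirDeriv, pdy_eq_dirDeriv] at h
      simp only [sub_apply, mulI_apply]
      linear_combination -h
    · simp only [map_add, map_sub, mulI_mulI]
      abel
  have hV1 : ∀ s ∈ U, HasDerivAt (fun s => ∫ z : ℝ × ℝ, z.1 ^ 2 * ‖ψ s z‖ ^ 2)
      (-4 * realPairing (ψ s) (mulFst (mulI (dirDeriv (1, 0) (ψ s))))) s := by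
    intro s hs
    obtain ⟨N, hN, hψ'⟩ := hpower s hs
    have h := hasDerivAt_realPairing_self (mulFst ∘L mulFst) (mulFst ∘L mulFst)
      realPairing_mulFst_mulFst_right hU (hcont.mono hsub) (hcont'.mono hsub) hd hs
    simp only [ContinuousLinearMap.comp_apply, hψ',
      realPairing_virial_first (ψ s) N hN] at h
    simp only [hmass]
    convert h using 1
    ring
  have hV2 : ∀ s ∈ U, HasDerivAt
      (fun s => -4 * realPairing (ψ s) (mulFst (mulI (dirDeriv (1, 0) (ψ s)))))
      (8 * (∫ z : ℝ × ℝ, ‖pdx (fun w => ψ s w) z‖ ^ 2)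
        - (4 * (p - 2) / p) * (∫ z : ℝ × ℝ, ‖ψ s z‖ ^ p)) s := by
    intro s hs
    obtain ⟨N, hN, hψ'⟩ := hpower s hs
    have h := (hasDerivAt_realPairing_self (mulFst ∘L mulI ∘L dirDeriv (1, 0))
      (dirDeriv (1, 0) ∘L mulI ∘L mulFst) (realPairing_mulFst_mulI_dirDeriv_right · · (1, 0))
      hU (hcont.mono hsub) (hcont'.mono hsub) hd hs).const_mul (-4)
    simp only [ContinuousLinearMap.comp_apply, hψ',
      realPairing_virial_second (ψ s) N hp hN _ rfl] at h
    rwa [hkin]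
  intro t ht htT
  have hmem : t ∈ U := ⟨ht, htT⟩
  have hev : deriv (fun s => ∫ z : ℝ × ℝ, z.1 ^ 2 * ‖ψ s z‖ ^ 2) =ᶠ[𝓝 t]
      fun s => -4 * realPairing (ψ s) (mulFst (mulI (dirDeriv (1, 0) (ψ s)))) := by
    filter_upwards [hU.mem_nhds hmem] with s hs using (hV1 s hs).deriv
  have hV := (hV2 t hmem).congr_of_eventuallyEq hev
  exact ⟨(hV1 t hmem).differentiableAt, hV.differentiableAt, hV.deriv⟩
end

section
/- Let p ≥ 6 and let ψ : [0,∞) × ℝ² → ℂ be a smooth global solution of i∂_t ψ + ∂_xx ψ − ∂_yyyy ψ + |ψ|^{p−2}ψ = 0 (pointwise) such that ψ(t,·) and ∂_t ψ(t,·) are Schwartz functions for every t ≥ 0, with all spatial derivatives and ∂_t ψ depending continuously on t with seminorm bounds locally uniform in t, and such that the energy is conserved: E(ψ(t,·)) = E(ψ(0,·)) for all t ≥ 0. Then E(ψ(0,·)) ≥ 0; equivalently, no such global solution exists with negative initial energy. -/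
open MeasureTheory

open scoped SchwartzMap LineDeriv

noncomputable section

namespace SchwartzPlane

/-- The derivative in the first variable, on Schwartz functions of the plane. -/
def dx : 𝓢(ℝ × ℝ, ℂ) →L[ℝ] 𝓢(ℝ × ℝ, ℂ) := LineDeriv.lineDerivOpCLM ℝ 𝓢(ℝ × ℝ, ℂ) ((1 : ℝ), (0 : ℝ))

/-- The derivative in the second variable, on Schwartz functions of the plane. -/
def dy : 𝓢(ℝ × ℝ, ℂ) →L[ℝ] 𝓢(ℝ × ℝ, ℂ) := LineDeriv.lineDerivOpCLM ℝ 𝓢(ℝ × ℝ, ℂ) ((0 : ℝ), (1 : ℝ))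

/-- Multiplication by the first coordinate. -/
def mulX : 𝓢(ℝ × ℝ, ℂ) →L[ℝ] 𝓢(ℝ × ℝ, ℂ) :=
  SchwartzMap.smulLeftCLM ℂ (fun z : ℝ × ℝ => z.1)

/-- The real `L²` inner product of two Schwartz functions. -/
def ip (f g : 𝓢(ℝ × ℝ, ℂ)) : ℝ := ∫ z, inner ℝ (f z) (g z)

lemma mulX_apply (f : 𝓢(ℝ × ℝ, ℂ)) (z : ℝ × ℝ) : mulX f z = z.1 • f z :=
  SchwartzMap.smulLeftCLM_apply_apply (ContinuousLinearMap.fst ℝ ℝ ℝ).hasTemperateGrowth f z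

lemma dx_apply (f : 𝓢(ℝ × ℝ, ℂ)) (z : ℝ × ℝ) : dx f z = fderiv ℝ f z (1, 0) := rfl

lemma dy_apply (f : 𝓢(ℝ × ℝ, ℂ)) (z : ℝ × ℝ) : dy f z = fderiv ℝ f z (0, 1) := rfl

lemma pdx_coe (f : 𝓢(ℝ × ℝ, ℂ)) : pdx f = dx f := by
  funext z
  have h : HasDerivAt (fun x : ℝ => (x, z.2)) ((1 : ℝ), (0 : ℝ)) z.1 :=
    (hasDerivAt_id z.1).prodMk (hasDerivAt_const z.1 z.2)
  exact ((f.hasFDerivAt z).comp_hasDerivAt z.1 h).deriv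

lemma pdy_coe (f : 𝓢(ℝ × ℝ, ℂ)) : pdy f = dy f := by
  funext z
  have h : HasDerivAt (fun y : ℝ => (z.1, y)) ((0 : ℝ), (1 : ℝ)) z.2 :=
    (hasDerivAt_const z.2 z.1).prodMk (hasDerivAt_id z.2)
  exact ((f.hasFDerivAt z).comp_hasDerivAt z.2 h).deriv

lemma integrable_inner (f g : 𝓢(ℝ × ℝ, ℂ)) : Integrable fun z => inner ℝ (f z) (g z) := by
  exact (SchwartzMap.pairing (innerSL ℝ) f g).integrable (μ := volume)

lemma ip_add_left (f g h : 𝓢(ℝ × ℝ, ℂ)) : ip (f + g) h = ip f h + ip g h := by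
  simp only [ip, add_apply, inner_add_left]
  exact integral_add (integrable_inner f h) (integrable_inner g h)

lemma ip_comm (f g : 𝓢(ℝ × ℝ, ℂ)) : ip f g = ip g f := by
  simp only [ip, real_inner_comm]

lemma ip_add_right (f g h : 𝓢(ℝ × ℝ, ℂ)) : ip f (g + h) = ip f g + ip f h := by
  rw [ip_comm, ip_add_left, ip_comm g, ip_comm h]

lemma ip_sub_right (f g h : 𝓢(ℝ × ℝ, ℂ)) : ip f (g - h) = ip f g - ip f h := by
  simp only [ip, sub_apply, inner_sub_right]
  exact integral_sub (integrable_inner f g) (integrable_inner f h)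

lemma ip_mulX (f g : 𝓢(ℝ × ℝ, ℂ)) : ip (mulX f) g = ip f (mulX g) := by
  simp only [ip, mulX_apply, real_inner_smul_left, real_inner_smul_right]

lemma ip_I_smul (f g : 𝓢(ℝ × ℝ, ℂ)) : ip (Complex.I • f) g = -ip f (Complex.I • g) := by
  simp only [ip, smul_apply]
  rw [← integral_neg]
  congr 1 with z
  simp [Complex.inner]
  ring

lemma ip_I_smul_self (f : 𝓢(ℝ × ℝ, ℂ)) : ip f (Complex.I • f) = 0 := by
  have h := ip_I_smul f f
  rw [ip_comm] at h
  linarith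

lemma ip_dx (f g : 𝓢(ℝ × ℝ, ℂ)) : ip f (dx g) = -ip (dx f) g :=
  SchwartzMap.integral_bilinear_lineDerivOp_right_eq_neg_left f g (innerSL ℝ) _

lemma ip_dy (f g : 𝓢(ℝ × ℝ, ℂ)) : ip f (dy g) = -ip (dy f) g :=
  SchwartzMap.integral_bilinear_lineDerivOp_right_eq_neg_left f g (innerSL ℝ) _

lemma hasFDerivAt_mulX (f : 𝓢(ℝ × ℝ, ℂ)) (z : ℝ × ℝ) :
    HasFDerivAt (mulX f)
      (z.1 • fderiv ℝ f z + (ContinuousLinearMap.fst ℝ ℝ ℝ).smulRight (f z)) z := by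
  have h : (mulX f : ℝ × ℝ → ℂ) = fun z => z.1 • f z := funext (mulX_apply f)
  rw [h]
  exact (ContinuousLinearMap.fst ℝ ℝ ℝ).hasFDerivAt.smul (f.hasFDerivAt z)

lemma dx_mulX (f : 𝓢(ℝ × ℝ, ℂ)) : dx (mulX f) = f + mulX (dx f) := by
  ext z
  rw [dx_apply, (hasFDerivAt_mulX f z).fderiv]
  simp [add_comm, mulX_apply, dx_apply]

lemma dy_mulX (f : 𝓢(ℝ × ℝ, ℂ)) : dy (mulX f) = mulX (dy f) := by
  ext z
  rw [dy_apply, (hasFDerivAt_mulX f z).fderiv, mulX_apply, dy_apply]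
  simp

lemma dx_I_smul (f : 𝓢(ℝ × ℝ, ℂ)) : dx (Complex.I • f) = Complex.I • dx f := by
  ext z
  have h : HasFDerivAt (Complex.I • f : 𝓢(ℝ × ℝ, ℂ)) (Complex.I • fderiv ℝ f z) z :=
    (f.hasFDerivAt z).const_smul Complex.I
  rw [dx_apply, h.fderiv]
  simp [dx_apply]

lemma dy_I_smul (f : 𝓢(ℝ × ℝ, ℂ)) : dy (Complex.I • f) = Complex.I • dy f := by
  ext z
  have h : HasFDerivAt (Complex.I • f : 𝓢(ℝ × ℝ, ℂ)) (Complex.I • fderiv ℝ f z) z :=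
    (f.hasFDerivAt z).const_smul Complex.I
  rw [dy_apply, h.fderiv]
  simp [dy_apply]

lemma mulX_I_smul (f : 𝓢(ℝ × ℝ, ℂ)) : mulX (Complex.I • f) = Complex.I • mulX f := by
  ext z
  simp [mulX_apply]
  ring

lemma dy_dx (f : 𝓢(ℝ × ℝ, ℂ)) : dy (dx f) = dx (dy f) := by
  ext z
  have hf := f.smooth 2
  have hd : DifferentiableAt ℝ (fderiv ℝ f) z :=
    (hf.fderiv_right (m := 1) (by norm_num)).differentiable (by norm_num) z
  have hs : IsSymmSndFDerivAt ℝ f z := hf.contDiffAt.isSymmSndFDerivAt (by simp)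
  have key (v w : ℝ × ℝ) : fderiv ℝ (fun y => fderiv ℝ f y v) z w = fderiv ℝ (fderiv ℝ f) z w v := by
    rw [fderiv_clm_apply hd (differentiableAt_const v)]
    simp
  change fderiv ℝ (fun y => fderiv ℝ f y (1, 0)) z (0, 1) =
    fderiv ℝ (fun y => fderiv ℝ f y (0, 1)) z (1, 0)
  rw [key, key, hs]

lemma ip_mulX_dx_self (f : 𝓢(ℝ × ℝ, ℂ)) : ip (mulX (dx f)) f = -ip f f / 2 := by
  have h := ip_dx (mulX f) f
  rw [dx_mulX, ip_add_left, ip_mulX, ip_comm] at h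
  linarith

lemma ip_dyyyy (f g : 𝓢(ℝ × ℝ, ℂ)) : ip f (dy (dy (dy (dy g)))) = ip (dy (dy f)) (dy (dy g)) := by
  rw [ip_dy, ip_dy]
  ring

/-- Schwartz functions depending continuously on a parameter decay uniformly over compact sets of
parameters. -/
lemma exists_uniform_decay {f : ℝ → 𝓢(ℝ × ℝ, ℂ)} {K : Set ℝ} (hK : IsCompact K)
    (hf : ContinuousOn f K) (k : ℕ) :
    ∃ C, ∀ t ∈ K, ∀ z, (1 + ‖z‖) ^ k * ‖f t z‖ ≤ C := by
  set q : Seminorm ℝ 𝓢(ℝ × ℝ, ℂ) :=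
    (Finset.Iic (k, 0)).sup fun m => SchwartzMap.seminorm ℝ m.1 m.2 with hq
  have hqc : Continuous q := by
    refine Finset.sup_induction (p := fun r : Seminorm ℝ 𝓢(ℝ × ℝ, ℂ) => Continuous r)
      continuous_const (fun r₁ h₁ r₂ h₂ => h₁.sup h₂) fun m _ => ?_
    exact (schwartz_withSeminorms ℝ (ℝ × ℝ) ℂ).continuous_seminorm m
  obtain ⟨C, hC⟩ := hK.exists_bound_of_continuousOn (hqc.comp_continuousOn hf)
  refine ⟨2 ^ k * C, fun t ht z => ?_⟩
  have h := SchwartzMap.one_add_le_sup_seminorm_apply (𝕜 := ℝ) (m := (k, 0)) le_rfl le_rfl (f t) z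
  rw [norm_iteratedFDeriv_zero] at h
  refine h.trans ?_
  gcongr
  exact (le_abs_self _).trans (hC t ht)

lemma hasDerivAt_ip {f f' g g' : ℝ → 𝓢(ℝ × ℝ, ℂ)} (hf : ContinuousOn f (Set.Ici 0))
    (hf' : ContinuousOn f' (Set.Ici 0)) (hg : ContinuousOn g (Set.Ici 0))
    (hg' : ContinuousOn g' (Set.Ici 0))
    (hff' : ∀ t, 0 < t → ∀ z, HasDerivAt (fun s => f s z) (f' t z) t)
    (hgg' : ∀ t, 0 < t → ∀ z, HasDerivAt (fun s => g s z) (g' t z) t) {t : ℝ} (ht : 0 < t) :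
    HasDerivAt (fun s => ip (f s) (g s)) (ip (f t) (g' t) + ip (f' t) (g t)) t := by
  set K := Set.Icc (t / 2) (2 * t)
  have hK : IsCompact K := isCompact_Icc
  have hKs : K ⊆ Set.Ici 0 := fun s hs => (by linarith [hs.1] : (0 : ℝ) ≤ s)
  have hKt : K ∈ nhds t := Icc_mem_nhds (by linarith) (by linarith)
  obtain ⟨A, hA⟩ := exists_uniform_decay hK (hf.mono hKs) 0
  obtain ⟨A', hA'⟩ := exists_uniform_decay hK (hf'.mono hKs) 0
  obtain ⟨B, hB⟩ := exists_uniform_decay hK (hg.mono hKs) 3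
  obtain ⟨B', hB'⟩ := exists_uniform_decay hK (hg'.mono hKs) 3
  have hweight : Integrable fun z : ℝ × ℝ => (1 + ‖z‖) ^ (-(3 : ℝ)) :=
    integrable_one_add_norm (by norm_num)
  have hdecay (z : ℝ × ℝ) {a b M N : ℝ} (ha : 0 ≤ a) (hb : 0 ≤ b) (haM : (1 + ‖z‖) ^ 0 * a ≤ M)
      (hbN : (1 + ‖z‖) ^ 3 * b ≤ N) : a * b ≤ M * N * (1 + ‖z‖) ^ (-(3 : ℝ)) := by
    have hp : (0 : ℝ) < (1 + ‖z‖) ^ 3 := by positivity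
    have hM : a ≤ M := by simpa using haM
    rw [Real.rpow_neg (by positivity), show (3 : ℝ) = ((3 : ℕ) : ℝ) by norm_num,
      Real.rpow_natCast, ← div_eq_mul_inv, le_div_iff₀ hp]
    calc a * b * (1 + ‖z‖) ^ 3 = a * ((1 + ‖z‖) ^ 3 * b) := by ring
      _ ≤ a * N := by gcongr
      _ ≤ M * N := by
        have hN : 0 ≤ N := le_trans (by positivity) hbN
        gcongr
  have key := (hasDerivAt_integral_of_dominated_loc_of_deriv_le (μ := (volume : Measure (ℝ × ℝ)))
    (F := fun s z => inner ℝ (f s z) (g s z))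
    (F' := fun s z => inner ℝ (f s z) (g' s z) + inner ℝ (f' s z) (g s z))
    (bound := fun z => (A * B' + A' * B) * (1 + ‖z‖) ^ (-(3 : ℝ))) hKt
    (Filter.Eventually.of_forall fun s => (integrable_inner (f s) (g s)).aestronglyMeasurable)
    (integrable_inner (f t) (g t))
    ((integrable_inner _ _).add (integrable_inner _ _)).aestronglyMeasurable
    (Filter.Eventually.of_forall fun z s hs => ?_)
    (hweight.const_mul _)
    (Filter.Eventually.of_forall fun z s hs => ?_)).2
  · rwa [integral_add (integrable_inner _ _) (integrable_inner _ _)] at key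
  · rw [add_mul]
    refine (norm_add_le _ _).trans (add_le_add ?_ ?_)
    · exact (norm_inner_le_norm _ _).trans
        (hdecay z (norm_nonneg _) (norm_nonneg _) (hA s hs z) (hB' s hs z))
    · exact (norm_inner_le_norm _ _).trans
        (hdecay z (norm_nonneg _) (norm_nonneg _) (hA' s hs z) (hB s hs z))
  · have hs0 : 0 < s := by linarith [hs.1]
    exact (hff' s hs0 z).inner ℝ (hgg' s hs0 z)

/-- The time derivative commutes with the spatial derivative `dx`. -/
lemma hasDerivAt_dx {ψ ψ' : ℝ → 𝓢(ℝ × ℝ, ℂ)}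
    (hsmooth : ContDiff ℝ (⊤ : ℕ∞) (fun q : ℝ × (ℝ × ℝ) => ψ q.1 q.2))
    (hderiv : ∀ t : ℝ, 0 ≤ t → ∀ z : ℝ × ℝ, HasDerivAt (fun s => ψ s z) (ψ' t z) t)
    {t : ℝ} (ht : 0 < t) (z : ℝ × ℝ) : HasDerivAt (fun s => dx (ψ s) z) (dx (ψ' t) z) t := by
  set F : ℝ × (ℝ × ℝ) → ℂ := fun q => ψ q.1 q.2 with hF
  have hF2 : ContDiff ℝ 2 F := contDiff_infty.1 hsmooth 2
  have hFd : Differentiable ℝ F := hF2.differentiable (by norm_num)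
  have hFdd : Differentiable ℝ (fderiv ℝ F) :=
    (hF2.fderiv_right (m := 1) (by norm_num)).differentiable (by norm_num)
  have hsymm : IsSymmSndFDerivAt ℝ F (t, z) := hF2.contDiffAt.isSymmSndFDerivAt (by simp)
  have hspace (s : ℝ) : dx (ψ s) z = fderiv ℝ F (s, z) (0, (1, 0)) := by
    have h : HasFDerivAt (ψ s) ((fderiv ℝ F (s, z)).comp
        ((0 : ℝ × ℝ →L[ℝ] ℝ).prod (ContinuousLinearMap.id ℝ (ℝ × ℝ)))) z :=
      (hFd (s, z)).hasFDerivAt.comp z ((hasFDerivAt_const s z).prodMk (hasFDerivAt_id z))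
    rw [dx_apply, h.fderiv]
    simp
  have htime (w : ℝ × ℝ) : ψ' t w = fderiv ℝ F (t, w) (1, 0) := by
    have h : HasDerivAt (fun s => ψ s w) (fderiv ℝ F (t, w) (1, 0)) t := by
      have hd : HasDerivAt (fun s : ℝ => (s, w)) ((1 : ℝ), (0 : ℝ × ℝ)) t :=
        (hasDerivAt_id t).prodMk (hasDerivAt_const t w)
      exact (hFd (t, w)).hasFDerivAt.comp_hasDerivAt t hd
    exact (hderiv t ht.le w).unique h
  have h₁ : HasDerivAt (fun s => fderiv ℝ F (s, z) (0, (1, 0)))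
      (fderiv ℝ (fderiv ℝ F) (t, z) (1, 0) (0, (1, 0))) t := by
    have h := (hFdd (t, z)).hasFDerivAt.comp_hasDerivAt t
      ((hasDerivAt_id t).prodMk (hasDerivAt_const t z))
    simpa using! h.clm_apply (hasDerivAt_const t ((0 : ℝ), ((1 : ℝ), (0 : ℝ))))
  have h₂ : dx (ψ' t) z = fderiv ℝ (fderiv ℝ F) (t, z) (0, (1, 0)) (1, 0) := by
    have h := ((hFdd (t, z)).hasFDerivAt.comp z
      ((hasFDerivAt_const t z).prodMk (hasFDerivAt_id z))).clm_apply
        (hasFDerivAt_const ((1 : ℝ), (0 : ℝ × ℝ)) z)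
    have hψ' : (ψ' t : ℝ × ℝ → ℂ) = fun w => fderiv ℝ F (t, w) (1, 0) := funext htime
    rw [dx_apply, hψ']
    erw [h.fderiv]
    simp
  rw [h₂, hsymm]
  simpa only [hspace] using h₁

/-- A Schwartz function which is pointwise the power nonlinearity of `u` satisfies the Pohozaev-type
identity obtained by pairing with `x ∂ₓ u`. -/
lemma ip_mulX_dx_nonlinearity {p : ℝ} (hp : 1 < p) {u N : 𝓢(ℝ × ℝ, ℂ)}
    (hN : ∀ z, N z = ((‖u z‖ ^ (p - 2) : ℝ) : ℂ) * u z) :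
    p * ip (mulX (dx u)) N = -ip u N := by
  have hinner (v : ℂ) (z : ℝ × ℝ) : inner ℝ v (N z) = ‖u z‖ ^ (p - 2) * inner ℝ (u z) v := by
    rw [hN, ← Complex.real_smul, real_inner_smul_right, real_inner_comm]
  have hself (z : ℝ × ℝ) : inner ℝ (u z) (N z) = ‖u z‖ ^ p := by
    rw [hinner, real_inner_self_eq_norm_sq, ← Real.rpow_natCast,
      ← Real.rpow_add' (norm_nonneg _) (by norm_num; linarith)]
    norm_num
  have hpow : ∀ z : ℝ × ℝ, HasFDerivAt (fun z => ‖u z‖ ^ p)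
      (((p * ‖u z‖ ^ (p - 2)) • innerSL ℝ (u z)).comp (fderiv ℝ u z)) z := fun z =>
    (hasFDerivAt_norm_rpow (u z) hp).comp z (u.hasFDerivAt z)
  have hderiv (z : ℝ × ℝ) : z.1 * (((p * ‖u z‖ ^ (p - 2)) • innerSL ℝ (u z)).comp (fderiv ℝ u z))
      (1, 0) = p * inner ℝ (mulX (dx u) z) (N z) := by
    rw [mulX_apply, dx_apply, hinner, real_inner_smul_right]
    simp only [ContinuousLinearMap.comp_apply, smul_apply, innerSL_apply_apply,
      smul_eq_mul]
    ring
  have hibp := integral_bilinear_hasFDerivAt_right_eq_neg_left_of_integrable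
    (μ := (volume : Measure (ℝ × ℝ))) (B := ContinuousLinearMap.mul ℝ ℝ) (v := ((1 : ℝ), (0 : ℝ)))
    (f := fun z : ℝ × ℝ => z.1) (f' := fun _ => ContinuousLinearMap.fst ℝ ℝ ℝ)
    (g := fun z => ‖u z‖ ^ p)
    (g' := fun z => ((p * ‖u z‖ ^ (p - 2)) • innerSL ℝ (u z)).comp (fderiv ℝ u z))
    ?_ ?_ ?_ (fun z _ => (ContinuousLinearMap.fst ℝ ℝ ℝ).hasFDerivAt) (fun z _ => hpow z)
  · simp only [ContinuousLinearMap.mul_apply', hderiv, ContinuousLinearMap.coe_fst', one_mul,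
      ← hself] at hibp
    rwa [integral_const_mul] at hibp
  · simpa [← hself] using! integrable_inner u N
  · simp only [ContinuousLinearMap.mul_apply', hderiv]
    exact (integrable_inner (mulX (dx u)) N).const_mul p
  · refine (integrable_inner (mulX u) N).congr (Filter.Eventually.of_forall fun z => ?_)
    beta_reduce
    rw [mulX_apply, real_inner_smul_left, hself]
    rfl

/-- The virial quantity `∫ x Im (ū ∂ₓu)`. -/
def virial (u : 𝓢(ℝ × ℝ, ℂ)) : ℝ := ip (Complex.I • u) (mulX (dx u))

lemma ip_mulX_mulX_of_equation {u u' N : 𝓢(ℝ × ℝ, ℂ)} (r : ℝ × ℝ → ℝ)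
    (hN : ∀ z, N z = (r z : ℂ) * u z)
    (hu' : u' = Complex.I • (dx (dx u) - dy (dy (dy (dy u))) + N)) :
    ip (mulX u) (mulX u') = 2 * virial u := by
  have hN0 : ip (mulX u) (mulX (Complex.I • N)) = 0 := by
    rw [ip, ← integral_zero]
    congr 1 with z
    simp [mulX_apply, hN, Complex.inner]
    ring
  have hy : ip (mulX u) (mulX (Complex.I • dy (dy (dy (dy u))))) = 0 := by
    rw [← ip_mulX, ← dy_I_smul, ← dy_I_smul, ← dy_I_smul, ← dy_I_smul, ip_dyyyy]
    simp only [dy_mulX, dy_I_smul, ip_mulX, mulX_I_smul]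
    rw [← mulX_I_smul, ← ip_mulX, ip_I_smul_self]
  have hx : ip (mulX u) (mulX (Complex.I • dx (dx u))) = 2 * virial u := by
    rw [← ip_mulX, ← dx_I_smul, ip_dx, dx_mulX, dx_mulX, map_add, ip_add_left, ip_add_left, virial,
      ip_I_smul]
    rw [ip_mulX (mulX (dx u)), mulX_I_smul, ip_I_smul_self, ip_mulX, mulX_I_smul]
    ring
  rw [hu', smul_add, smul_sub, map_add, map_sub, ip_add_right, ip_sub_right, hN0, hy, hx]
  ring

lemma virial_identity {p : ℝ} (hp : 1 < p) {u u' N : 𝓢(ℝ × ℝ, ℂ)}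
    (hN : ∀ z, N z = ((‖u z‖ ^ (p - 2) : ℝ) : ℂ) * u z)
    (hu' : u' = Complex.I • (dx (dx u) - dy (dy (dy (dy u))) + N)) :
    ip (Complex.I • u) (mulX (dx u')) + ip (Complex.I • u') (mulX (dx u)) =
      2 * ip (dx u) (dx u) - (p - 2) / p * ip u N := by
  set H := dx (dx u) - dy (dy (dy (dy u))) + N with hH
  have hI : Complex.I • u' = -H := by
    rw [hu', smul_smul, Complex.I_mul_I, neg_one_smul]
  have hfirst : ip (Complex.I • u) (mulX (dx u')) = -ip u H - ip (mulX (dx u)) H := by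
    have hII : Complex.I • (Complex.I • H) = -H := by
      rw [smul_smul, Complex.I_mul_I, neg_one_smul]
    have hneg (v : 𝓢(ℝ × ℝ, ℂ)) : ip v (-H) = -ip v H := by
      simpa [ip] using ip_sub_right v 0 H
    rw [← ip_mulX, ip_dx, dx_mulX, dx_I_smul, mulX_I_smul, ip_add_left, hu', ip_I_smul, ip_I_smul,
      hII, hneg, hneg]
    ring
  have hsecond : ip (Complex.I • u') (mulX (dx u)) = -ip (mulX (dx u)) H := by
    have h := ip_sub_right (mulX (dx u)) 0 H
    rw [hI, ip_comm]
    simpa [ip] using h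
  have hpair : ip u H = -ip (dx u) (dx u) - ip (dy (dy u)) (dy (dy u)) + ip u N := by
    rw [hH, ip_add_right, ip_sub_right, ip_dx, ip_dyyyy]
  have hX : ip (mulX (dx u)) (dx (dx u)) = -ip (dx u) (dx u) / 2 := by
    have h := ip_mulX_dx_self (dx u)
    rwa [ip_mulX, ip_comm, ip_mulX, ← ip_mulX] at h
  have hY : ip (mulX (dx u)) (dy (dy (dy (dy u)))) = -ip (dy (dy u)) (dy (dy u)) / 2 := by
    rw [ip_dyyyy, dy_mulX, dy_mulX, dy_dx, dy_dx, ip_mulX_dx_self]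
  have hNl : ip (mulX (dx u)) N = -ip u N / p := by
    rw [eq_div_iff (by linarith), mul_comm, ip_mulX_dx_nonlinearity hp hN]
  have hscal : ip (mulX (dx u)) H =
      -ip (dx u) (dx u) / 2 + ip (dy (dy u)) (dy (dy u)) / 2 - ip u N / p := by
    rw [hH, ip_add_right, ip_sub_right, hX, hY, hNl]
    ring
  rw [hfirst, hsecond, hpair, hscal]
  field_simp
  ring

/-- An upper bound `c` for the second derivative of a nonnegative quantity on a half-line is itself
nonnegative. -/
lemma nonneg_of_hasDerivAt_le {V W W' : ℝ → ℝ} {c : ℝ} (hV0 : ∀ t, 0 ≤ V t)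
    (hV : ∀ t, 0 < t → HasDerivAt V (W t) t) (hW : ∀ t, 0 < t → HasDerivAt W (W' t) t)
    (hW' : ∀ t, 0 < t → W' t ≤ c) : 0 ≤ c := by
  by_contra! hc
  have hanti {f f' : ℝ → ℝ} (hf : ∀ t, 0 < t → HasDerivAt f (f' t) t)
      (hf' : ∀ t, 1 ≤ t → f' t ≤ 0) : ∀ t, 1 ≤ t → f t ≤ f 1 := by
    have h : AntitoneOn f (Set.Ici 1) := by
      refine antitoneOn_of_deriv_nonpos (convex_Ici 1)
        (fun t ht => (hf t (zero_lt_one.trans_le ht)).continuousAt.continuousWithinAt)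
        (fun t ht => ?_) (fun t ht => ?_)
      all_goals rw [interior_Ici, Set.mem_Ioi] at ht
      · exact (hf t (zero_lt_one.trans ht)).differentiableAt.differentiableWithinAt
      · rw [(hf t (zero_lt_one.trans ht)).deriv]
        exact hf' t ht.le
    exact fun t ht => h Set.self_mem_Ici ht ht
  have h₁ : ∀ t, 1 ≤ t → W t - c * t ≤ W 1 - c * 1 :=
    hanti (fun t ht => (hW t ht).sub ((hasDerivAt_id t).const_mul c))
      (fun t ht => by linarith [hW' t (by linarith)])
  have h₂ : ∀ t, 1 ≤ t → V t - (W 1 * (t - 1) + c / 2 * (t - 1) ^ 2) ≤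
      V 1 - (W 1 * (1 - 1) + c / 2 * (1 - 1) ^ 2) := by
    refine hanti (f' := fun t => W t - (W 1 + c * (t - 1))) (fun t ht => (hV t ht).sub ?_)
      (fun t ht => by linarith [h₁ t ht])
    have h := (hasDerivAt_id t).sub_const 1
    refine ((h.const_mul (W 1)).add ((h.pow 2).const_mul (c / 2))).congr_deriv ?_
    simp
    ring
  have hlim : ∃ s : ℝ, 0 ≤ s ∧ V 1 + W 1 * s + c / 2 * s ^ 2 < 0 := by
    refine ⟨1 + (2 * |W 1| + 2 * V 1) / (-c), ?_, ?_⟩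
    · have := hV0 1
      have : 0 < -c := by linarith
      positivity
    · have hV1 := hV0 1
      have hc' : 0 < -c := by linarith
      set s := 1 + (2 * |W 1| + 2 * V 1) / (-c) with hs
      have hs1 : 1 ≤ s := by
        rw [hs]
        have : 0 ≤ (2 * |W 1| + 2 * V 1) / (-c) := by positivity
        linarith
      have hcs : c * s = c - (2 * |W 1| + 2 * V 1) := by
        have hcne : c ≠ 0 := hc.ne
        rw [hs]
        field_simp
        ring
      have hW1 := le_abs_self (W 1)
      nlinarith [mul_nonneg (sub_nonneg.2 hs1) hV1, mul_nonneg (sub_nonneg.2 hW1)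
        (zero_le_one.trans hs1)]
  obtain ⟨s, hs0, hs⟩ := hlim
  have h := h₂ (1 + s) (by linarith)
  have := hV0 (1 + s)
  ring_nf at h hs
  linarith

lemma ip_self_nonneg (f : 𝓢(ℝ × ℝ, ℂ)) : 0 ≤ ip f f :=
  integral_nonneg fun _ => real_inner_self_nonneg

lemma ip_self (f : 𝓢(ℝ × ℝ, ℂ)) : ip f f = ∫ z, ‖f z‖ ^ 2 := by
  simp only [ip, real_inner_self_eq_norm_sq]

lemma ip_nonlinearity {p : ℝ} (hp : p ≠ 0) {u N : 𝓢(ℝ × ℝ, ℂ)}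
    (hN : ∀ z, N z = ((‖u z‖ ^ (p - 2) : ℝ) : ℂ) * u z) : ip u N = Pf p u := by
  rw [ip, Pf]
  congr 1 with z
  rw [hN, ← Complex.real_smul, real_inner_smul_right, real_inner_self_eq_norm_sq,
    ← Real.rpow_natCast, ← Real.rpow_add' (norm_nonneg _) (by simpa using hp)]
  norm_num

lemma Ef_eq {p : ℝ} (hp : p ≠ 0) {u N : 𝓢(ℝ × ℝ, ℂ)}
    (hN : ∀ z, N z = ((‖u z‖ ^ (p - 2) : ℝ) : ℂ) * u z) :
    Ef p u = ip (dx u) (dx u) / 2 + ip (dy (dy u)) (dy (dy u)) / 2 - ip u N / p := by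
  rw [Ef, Xf, Yf, pdyy, pdx_coe, pdy_coe, pdy_coe, ip_self, ip_self, ip_nonlinearity hp hN]

end SchwartzPlane

end

open SchwartzPlane

/-- No global solution with conserved energy can have negative initial energy when p ≥ 6. -/
theorem stmt_19 (p : ℝ) (hp : 6 ≤ p)
    (ψ ψ' : ℝ → SchwartzMap (ℝ × ℝ) ℂ)
    (hsmooth : ContDiff ℝ (⊤ : ℕ∞) (fun q : ℝ × (ℝ × ℝ) => ψ q.1 q.2))
    (hcont : ContinuousOn ψ (Set.Ici (0 : ℝ)))
    (hcont' : ContinuousOn ψ' (Set.Ici (0 : ℝ)))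
    (hderiv : ∀ t : ℝ, 0 ≤ t → ∀ z : ℝ × ℝ,
      HasDerivAt (fun s => ψ s z) (ψ' t z) t)
    (hpde : ∀ t : ℝ, 0 ≤ t → ∀ z : ℝ × ℝ,
      Complex.I * ψ' t z + pdxx (fun w => ψ t w) z - pdyyyy (fun w => ψ t w) z
        + ((‖ψ t z‖ ^ (p - 2) : ℝ) : ℂ) * ψ t z = 0)
    (hE : ∀ t : ℝ, 0 ≤ t → Ef p (fun z => ψ t z) = Ef p (fun z => ψ 0 z)) :
    0 ≤ Ef p (fun z => ψ 0 z) := by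
  have hp0 : p ≠ 0 := by linarith
  set N : ℝ → 𝓢(ℝ × ℝ, ℂ) := fun t =>
    -(Complex.I • ψ' t) - dx (dx (ψ t)) + dy (dy (dy (dy (ψ t)))) with hNdef
  have hN : ∀ t, 0 ≤ t → ∀ z, N t z = ((‖ψ t z‖ ^ (p - 2) : ℝ) : ℂ) * ψ t z := by
    intro t ht z
    have h := hpde t ht z
    change Complex.I * ψ' t z + pdxx (ψ t) z - pdyyyy (ψ t) z + _ = 0 at h
    simp only [pdxx, pdyyyy, pdx_coe, pdy_coe] at h
    simp only [hNdef, add_apply, sub_apply, neg_apply, smul_apply, smul_eq_mul]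
    linear_combination -h
  have hψ' (t : ℝ) :
      ψ' t = Complex.I • (dx (dx (ψ t)) - dy (dy (dy (dy (ψ t)))) + N t) := by
    have h : dx (dx (ψ t)) - dy (dy (dy (dy (ψ t)))) + N t = -(Complex.I • ψ' t) := by
      simp only [hNdef]
      abel
    rw [h, smul_neg, smul_smul, Complex.I_mul_I, neg_one_smul, neg_neg]
  have hmul {f f' : ℝ → 𝓢(ℝ × ℝ, ℂ)}
      (h : ∀ t, 0 < t → ∀ z, HasDerivAt (fun s => f s z) (f' t z) t) :
      ∀ t, 0 < t → ∀ z, HasDerivAt (fun s => mulX (f s) z) (mulX (f' t) z) t := by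
    intro t ht z
    simp only [mulX_apply]
    exact (h t ht z).const_smul z.1
  have hψ : ∀ t, 0 < t → ∀ z, HasDerivAt (fun s => ψ s z) (ψ' t z) t :=
    fun t ht => hderiv t ht.le
  have hV : ∀ t, 0 < t →
      HasDerivAt (fun s => ip (mulX (ψ s)) (mulX (ψ s))) (4 * virial (ψ t)) t := by
    intro t ht
    have hm := mulX.continuous.comp_continuousOn hcont
    have hm' := mulX.continuous.comp_continuousOn hcont'
    refine (hasDerivAt_ip hm hm' hm hm' (hmul hψ) (hmul hψ) ht).congr_deriv ?_
    have h := ip_mulX_mulX_of_equation _ (hN t ht.le) (hψ' t)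
    simp only [Function.comp_apply]
    rw [ip_comm (mulX (ψ' t)), h]
    ring
  have hW : ∀ t, 0 < t → HasDerivAt (fun s => 4 * virial (ψ s))
      (4 * (2 * ip (dx (ψ t)) (dx (ψ t)) - (p - 2) / p * ip (ψ t) (N t))) t := by
    intro t ht
    have hm := (mulX.comp dx).continuous.comp_continuousOn hcont
    have hm' := (mulX.comp dx).continuous.comp_continuousOn hcont'
    have h := hasDerivAt_ip (hcont.const_smul Complex.I) (hcont'.const_smul Complex.I) hm hm'
      (fun t ht z => (hψ t ht z).const_smul Complex.I)
      (hmul fun t ht => hasDerivAt_dx hsmooth hderiv ht) ht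
    rw [← virial_identity (by linarith) (hN t ht.le) (hψ' t)]
    exact h.const_mul 4
  have hc := nonneg_of_hasDerivAt_le (c := 16 * Ef p (fun z => ψ 0 z))
    (fun t => ip_self_nonneg (mulX (ψ t))) hV hW fun t ht => by
      have hEt := (hE t ht.le).symm.trans (Ef_eq hp0 (hN t ht.le))
      have hP : 0 ≤ ip (ψ t) (N t) := by
        rw [ip_nonlinearity hp0 (hN t ht.le)]
        exact integral_nonneg fun z => by positivity
      have hY := ip_self_nonneg (dy (dy (ψ t)))
      have hrest : 0 ≤ (p - 6) / p * ip (ψ t) (N t) :=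
        mul_nonneg (div_nonneg (by linarith) (by linarith)) hP
      have hsplit : (p - 2) / p * ip (ψ t) (N t) =
          (p - 6) / p * ip (ψ t) (N t) + 4 * (ip (ψ t) (N t) / p) := by
        field_simp
        ring
      rw [hEt, hsplit]
      linarith
  linarith
end
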